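/- Let E be a Banach space, τ > 0, L ≥ 0, and let g : ℝ × ℝ → E satisfy ‖g(s, w) − g(s′, w′)‖ ≤ L·(|s − s′| + |w − w′|) for all s, w, s′, w′ ∈ [0, τ]. Then ‖∫₀^τ ∫₀^s g(s, w) dw ds − (τ²/2)·g(τ/2, τ/2)‖ ≤ L·τ³/2. -/

import Mathlib

/-- Triangular-domain quadrature error bound in a Banach space: if `g` is Lipschitz
with constant `L` (jointly, in the sum metric) on `[0,τ]²`, then
`‖∫₀^τ ∫₀^s g(s,w) dw ds − (τ²/2) g(τ/2, τ/2)‖ ≤ Lτ³/2`. -/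
theorem triangular_quadrature_error
    {E : Type*} [NormedAddCommGroup E] [NormedSpace ℝ E] [CompleteSpace E]
    (τ L : ℝ) (hτ : 0 < τ) (hL : 0 ≤ L)
    (g : ℝ → ℝ → E)
    (hlip : ∀ s ∈ Set.Icc (0 : ℝ) τ, ∀ w ∈ Set.Icc (0 : ℝ) τ,
      ∀ s' ∈ Set.Icc (0 : ℝ) τ, ∀ w' ∈ Set.Icc (0 : ℝ) τ,
        ‖g s w - g s' w'‖ ≤ L * (|s - s'| + |w - w'|)) :
    ‖(∫ s in (0:ℝ)..τ, ∫ w in (0:ℝ)..s, g s w) - (τ ^ 2 / 2) • g (τ / 2) (τ / 2)‖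
      ≤ L * τ ^ 3 / 2 := by
  have hmem : ∀ x : ℝ, max 0 (min x τ) ∈ Set.Icc (0 : ℝ) τ := fun x =>
    ⟨le_max_left _ _, max_le hτ.le (min_le_right _ _)⟩
  have hid : ∀ x ∈ Set.Icc (0 : ℝ) τ, max 0 (min x τ) = x := fun x hx => by
    rw [min_eq_left hx.2, max_eq_right hx.1]
  have hhalf : τ / 2 ∈ Set.Icc (0 : ℝ) τ := ⟨by linarith, by linarith⟩
  obtain ⟨G, hG⟩ : ∃ G : ℝ → ℝ → E,
      ∀ s w, G s w = g (max 0 (min s τ)) (max 0 (min w τ)) := ⟨_, fun _ _ => rfl⟩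
  set c := g (τ / 2) (τ / 2) with hc
  have hcont : Continuous (Function.uncurry G) := by
    rw [continuous_iff_continuousAt]
    intro a
    rw [ContinuousAt, tendsto_iff_norm_sub_tendsto_zero]
    refine squeeze_zero (g := fun x : ℝ × ℝ =>
      L * (|max 0 (min x.1 τ) - max 0 (min a.1 τ)| + |max 0 (min x.2 τ) - max 0 (min a.2 τ)|))
      (fun _ => norm_nonneg _) (fun x => ?_) ?_
    · simp only [Function.uncurry, hG]
      exact hlip _ (hmem _) _ (hmem _) _ (hmem _) _ (hmem _)
    · refine Continuous.tendsto' (by fun_prop) _ _ (by simp)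
  have hinner : Continuous (fun s => ∫ w in (0:ℝ)..s, G s w) :=
    intervalIntegral.continuous_parametric_intervalIntegral_of_continuous hcont continuous_id
  have hGs : ∀ s, Continuous (G s) := fun s => hcont.comp (by fun_prop : Continuous (fun w => (s, w)))
  have h1 : (∫ s in (0:ℝ)..τ, ∫ w in (0:ℝ)..s, g s w) = ∫ s in (0:ℝ)..τ, ∫ w in (0:ℝ)..s, G s w := by
    refine intervalIntegral.integral_congr fun s hs => ?_
    rw [Set.uIcc_of_le hτ.le] at hs
    refine intervalIntegral.integral_congr fun w hw => ?_
    rw [Set.uIcc_of_le hs.1] at hw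
    simp only [hG]
    rw [hid s hs, hid w ⟨hw.1, hw.2.trans hs.2⟩]
  have h2 : (τ ^ 2 / 2) • c = ∫ s in (0:ℝ)..τ, s • c := by
    rw [intervalIntegral.integral_smul_const, integral_id]
    simp
  rw [h1, h2, ← intervalIntegral.integral_sub (hinner.intervalIntegrable _ _)
    ((by fun_prop : Continuous fun s : ℝ => s • c).intervalIntegrable _ _)]
  have h3 : L * τ ^ 3 / 2 = ∫ s in (0:ℝ)..τ, (L * τ) * s := by
    rw [intervalIntegral.integral_const_mul, integral_id]
    ring
  rw [h3]
  refine intervalIntegral.norm_integral_le_of_norm_le hτ.le (Filter.Eventually.of_forall ?_)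
    ((by fun_prop : Continuous fun s : ℝ => (L * τ) * s).intervalIntegrable _ _)
  intro s hs
  have h4 : s • c = ∫ _w in (0:ℝ)..s, c := by simp
  rw [h4, ← intervalIntegral.integral_sub ((hGs s).intervalIntegrable _ _)
    (continuous_const.intervalIntegrable _ _)]
  refine (intervalIntegral.norm_integral_le_of_norm_le_const (C := L * τ) fun w hw => ?_).trans ?_
  · rw [Set.uIoc_of_le hs.1.le] at hw
    have hs' : s ∈ Set.Icc (0 : ℝ) τ := ⟨hs.1.le, hs.2⟩
    have hw' : w ∈ Set.Icc (0 : ℝ) τ := ⟨hw.1.le, hw.2.trans hs.2⟩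
    rw [hG, hid s hs', hid w hw']
    refine (hlip s hs' w hw' _ hhalf _ hhalf).trans (mul_le_mul_of_nonneg_left ?_ hL)
    have a1 : |s - τ / 2| ≤ τ / 2 := abs_le.2 ⟨by linarith [hs'.1], by linarith [hs'.2]⟩
    have a2 : |w - τ / 2| ≤ τ / 2 := abs_le.2 ⟨by linarith [hw'.1], by linarith [hw'.2]⟩
    linarith
  · rw [sub_zero, abs_of_pos hs.1]
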